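/- In the Fraïssé class 𝔗 of tree structures, 'separated' and 'stably separated' coincide: for any tree structure X ∈ 𝔗 and distinct elements a, b ∈ X, a and b are separated in X if and only if they are stably separated in X. -/

import Mathlib

/-! # Relational structures, embeddings, amalgamations, Fraïssé classes -/

namespace Paper

/-- A relational signature: a set `I` of relation symbols with arities `≥ 1`. -/
structure Signature : Type 1 where
  I : Type
  arity : I → ℕ
  arity_pos : ∀ i, 1 ≤ arity i

variable {σ : Signature}

/-- A (finite relational) structure for the signature `σ`. -/
structure Struc (σ : Signature) : Type 1 where
  carrier : Type
  [fin : Finite carrier]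
  rel : ∀ i : σ.I, (Fin (σ.arity i) → carrier) → Prop

attribute [instance] Struc.fin

/-- An embedding of structures: an injection under which the relations on the source are
exactly the restrictions of the relations on the target. -/
structure Emb (X Y : Struc σ) : Type where
  toFun : X.carrier → Y.carrier
  inj : Function.Injective toFun
  rel_iff : ∀ (i : σ.I) (v : Fin (σ.arity i) → X.carrier),
    Y.rel i (fun j => toFun (v j)) ↔ X.rel i v

/-- The identity embedding. -/
def Emb.id (X : Struc σ) : Emb X X where
  toFun := fun x => x
  inj := fun _ _ h => h
  rel_iff := fun _ _ => Iff.rfl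

/-- Composition of embeddings. -/
def Emb.comp {X Y Z : Struc σ} (g : Emb Y Z) (f : Emb X Y) : Emb X Z where
  toFun := fun x => g.toFun (f.toFun x)
  inj := fun _ _ h => f.inj (g.inj h)
  rel_iff := fun i v => (g.rel_iff i fun j => f.toFun (v j)).trans (f.rel_iff i v)

/-- An embedding is an isomorphism if it is surjective. -/
def Emb.IsIso {X Y : Struc σ} (f : Emb X Y) : Prop := Function.Surjective f.toFun

/-- Two structures are isomorphic. -/
def StrucIso (X Y : Struc σ) : Prop := ∃ f : Emb X Y, f.IsIso

theorem strucIso_refl (X : Struc σ) : StrucIso X X := ⟨Emb.id X, fun y => ⟨y, rfl⟩⟩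

/-- The induced structure on a subset of the carrier. -/
def Struc.restrict (X : Struc σ) (S : Set X.carrier) : Struc σ where
  carrier := S
  rel := fun i v => X.rel i (fun j => (v j : X.carrier))

/-- The inclusion embedding of an induced substructure into the whole structure. -/
def Struc.subEmb (X : Struc σ) (S : Set X.carrier) : Emb (X.restrict S) X where
  toFun := fun a => a.1
  inj := fun _ _ h => Subtype.ext h
  rel_iff := fun _ _ => Iff.rfl

/-- The inclusion embedding between induced substructures on nested subsets. -/
def Struc.inclEmb (X : Struc σ) {S T : Set X.carrier} (h : S ⊆ T) :
    Emb (X.restrict S) (X.restrict T) where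
  toFun := fun a => ⟨a.1, h a.2⟩
  inj := fun a b hab => Subtype.ext (Subtype.mk_eq_mk.mp (by exact hab))
  rel_iff := fun _ _ => Iff.rfl

/-- An amalgamation of `Y₁` and `Y₂` over `X` (along `i₁`, `i₂`). -/
structure Amalg {X Y₁ Y₂ : Struc σ} (i₁ : Emb X Y₁) (i₂ : Emb X Y₂) : Type 1 where
  Z : Struc σ
  j₁ : Emb Y₁ Z
  j₂ : Emb Y₂ Z
  comm : ∀ x, j₁.toFun (i₁.toFun x) = j₂.toFun (i₂.toFun x)
  surj : ∀ z, z ∈ Set.range j₁.toFun ∪ Set.range j₂.toFun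

/-- Isomorphism of amalgamations: a structure isomorphism commuting with the two
embeddings. -/
def Amalg.Iso {X Y₁ Y₂ : Struc σ} {i₁ : Emb X Y₁} {i₂ : Emb X Y₂}
    (A B : Amalg i₁ i₂) : Prop :=
  ∃ f : Emb A.Z B.Z, f.IsIso ∧ (∀ y, f.toFun (A.j₁.toFun y) = B.j₁.toFun y) ∧
    (∀ y, f.toFun (A.j₂.toFun y) = B.j₂.toFun y)

/-- A structure lies in the class `F` up to isomorphism. -/
def MemUpIso (F : Set (Struc σ)) (X : Struc σ) : Prop := ∃ W ∈ F, StrucIso X W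

theorem memUpIso_of_mem {F : Set (Struc σ)} {X : Struc σ} (h : X ∈ F) : MemUpIso F X :=
  ⟨X, h, strucIso_refl X⟩

/-- A Fraïssé class. -/
structure IsFraisse (F : Set (Struc σ)) : Prop where
  nonempty : F.Nonempty
  finClasses : ∀ n : ℕ, ∃ (m : ℕ) (r : Fin m → Struc σ),
    ∀ X ∈ F, Nat.card X.carrier = n → ∃ α, StrucIso X (r α)
  hereditary : ∀ X ∈ F, ∀ Y : Struc σ, Nonempty (Emb Y X) → MemUpIso F Y
  amalg : ∀ (X Y₁ Y₂ : Struc σ), X ∈ F → Y₁ ∈ F → Y₂ ∈ F →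
    ∀ (i₁ : Emb X Y₁) (i₂ : Emb X Y₂), ∃ A : Amalg i₁ i₂, MemUpIso F A.Z

theorem pair_compl_subset_left {α : Type*} (a b : α) : ({a, b} : Set α)ᶜ ⊆ ({a} : Set α)ᶜ :=
  Set.compl_subset_compl.mpr (fun _ hx => Set.mem_insert_iff.mpr (Or.inl hx))

theorem pair_compl_subset_right {α : Type*} (a b : α) : ({a, b} : Set α)ᶜ ⊆ ({b} : Set α)ᶜ :=
  Set.compl_subset_compl.mpr (fun _ hx => Set.mem_insert_iff.mpr (Or.inr hx))

/-- The canonical amalgamation of `X∖{a}` and `X∖{b}` over `X∖{a,b}`, namely `X` itself. -/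
def canonAmalg (X : Struc σ) (a b : X.carrier) (hab : a ≠ b) :
    Amalg (X.inclEmb (pair_compl_subset_left a b)) (X.inclEmb (pair_compl_subset_right a b)) where
  Z := X
  j₁ := X.subEmb ({a} : Set X.carrier)ᶜ
  j₂ := X.subEmb ({b} : Set X.carrier)ᶜ
  comm := fun _ => rfl
  surj := fun z => by
    by_cases hz : z = a
    · exact Or.inr ⟨⟨z, by simp only [Set.mem_compl_iff, Set.mem_singleton_iff, hz]; exact hab⟩, rfl⟩
    · exact Or.inl ⟨⟨z, by simp [hz]⟩, rfl⟩

/-- Two distinct elements `a b` of `X` are separated (relative to the class `F`) if `X` is,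
up to isomorphism of amalgamations, the unique amalgamation of `X∖{a}` and `X∖{b}` over
`X∖{a,b}` lying in `F`. -/
def Separated (F : Set (Struc σ)) (X : Struc σ) (a b : X.carrier) (hab : a ≠ b) : Prop :=
  ∀ A : Amalg (X.inclEmb (pair_compl_subset_left a b)) (X.inclEmb (pair_compl_subset_right a b)),
    MemUpIso F A.Z → A.Iso (canonAmalg X a b hab)

/-- Stably separated: every embedding into a member of `F` sends `a`, `b` to separated
elements. -/
def StablySeparated (F : Set (Struc σ)) (X : Struc σ) (a b : X.carrier) (hab : a ≠ b) : Prop :=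
  ∀ X' : Struc σ, MemUpIso F X' → ∀ f : Emb X X',
    Separated F X' (f.toFun a) (f.toFun b) (fun h => hab (f.inj h))

/-- Isomorphism of marked structures. -/
def MarkedIso (X : Struc σ) (a : X.carrier) (Y : Struc σ) (b : Y.carrier) : Prop :=
  ∃ f : Emb X Y, f.IsIso ∧ f.toFun a = b

/-- `b` is extraneous in the marked structure `(X, a)` if it is separated from `a`. -/
def Extraneous (F : Set (Struc σ)) (X : Struc σ) (a b : X.carrier) : Prop :=
  ∃ h : a ≠ b, Separated F X a b h

/-- A marked structure is minimal if it has no extraneous elements. -/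
def MinimalMarked (F : Set (Struc σ)) (X : Struc σ) (a : X.carrier) : Prop :=
  ∀ b : X.carrier, ¬ Extraneous F X a b

/-- `f : W → X` is a one-point extension missing exactly `a`. -/
def IsOnePointExt {W X : Struc σ} (f : Emb W X) (a : X.carrier) : Prop :=
  Set.range f.toFun = ({a} : Set X.carrier)ᶜ

end Paper

/-! # Trees and tree structures -/

namespace Paper

/-- A finite tree: a finite connected acyclic simple graph. -/
structure FinTree : Type 1 where
  V : Type
  [fin : Fintype V]
  [dec : DecidableEq V]
  G : SimpleGraph V
  [adjDec : DecidableRel G.Adj]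
  isTree : G.IsTree

attribute [instance] FinTree.fin FinTree.dec FinTree.adjDec

/-- A leaf is a vertex of valence `≤ 1` (in a tree with at least two vertices this is the
same as valence exactly `1`; in a tree with at most two vertices every vertex is a leaf). -/
def FinTree.IsLeaf (T : FinTree) (v : T.V) : Prop := T.G.degree v ≤ 1

instance (T : FinTree) : DecidablePred T.IsLeaf := fun v => by
  unfold FinTree.IsLeaf; infer_instance

/-- A node is a vertex which is not a leaf. -/
def FinTree.IsNode (T : FinTree) (v : T.V) : Prop := ¬ T.IsLeaf v

/-- A tree is reduced if it has no node of valence 2. -/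
def FinTree.Reduced (T : FinTree) : Prop := ∀ v : T.V, T.G.degree v ≠ 2

/-- The quaternary relation on the vertices of a tree: the four vertices are pairwise
distinct and the path from `x₁` to `x₂` has a common edge with the path from `y₁` to
`y₂`. -/
def FinTree.pathRel (T : FinTree) (x₁ x₂ y₁ y₂ : T.V) : Prop :=
  ([x₁, x₂, y₁, y₂] : List T.V).Nodup ∧
  ∃ (p : T.G.Walk x₁ x₂) (q : T.G.Walk y₁ y₂), p.IsPath ∧ q.IsPath ∧
    ∃ e : Sym2 T.V, e ∈ p.edges ∧ e ∈ q.edges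

/-- The signature of tree structures: a single quaternary relation. -/
abbrev treeSig : Signature where
  I := Unit
  arity := fun _ => 4
  arity_pos := fun _ => by norm_num

/-- The leaf structure `L(T)` of a tree `T`: the set of leaves together with the quaternary
relation `R(x₁,x₂;y₁,y₂)` expressing that the paths `x₁–x₂` and `y₁–y₂` share an edge. -/
def FinTree.leafStruc (T : FinTree) : Struc treeSig where
  carrier := {v : T.V // T.IsLeaf v}
  rel := fun _ v => T.pathRel (v 0).1 (v 1).1 (v 2).1 (v 3).1

/-- The class `𝔗` of all tree structures (together with the empty structure, the leaf
structure of the empty tree). -/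
def TreeClass : Set (Struc treeSig) :=
  {A | IsEmpty A.carrier ∨ ∃ T : FinTree, StrucIso A T.leafStruc}

/-- The level of a tree is at most `n`: every vertex has valence at most `n`. -/
def FinTree.LevelLe (T : FinTree) (n : ℕ) : Prop := ∀ v : T.V, T.G.degree v ≤ n

/-- The class `𝔗_n` of tree structures of level at most `n`. -/
def TreeClassN (n : ℕ) : Set (Struc treeSig) :=
  {A | IsEmpty A.carrier ∨ ∃ T : FinTree, T.LevelLe n ∧ StrucIso A T.leafStruc}

theorem leafStruc_mem_treeClass (T : FinTree) : T.leafStruc ∈ TreeClass :=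
  Or.inr ⟨T, strucIso_refl _⟩

/-- The set of leaves of a tree. -/
def FinTree.leafFinset (T : FinTree) : Finset T.V := Finset.univ.filter T.IsLeaf

/-- The number of leaves, `ℓ(T)`. -/
def FinTree.nLeaves (T : FinTree) : ℕ := T.leafFinset.card

/-- The set of nodes of a tree. -/
def FinTree.nodeFinset (T : FinTree) : Finset T.V := Finset.univ.filter (fun v => ¬ T.IsLeaf v)

/-- The number of nodes, `n(T)`. -/
def FinTree.nNodes (T : FinTree) : ℕ := T.nodeFinset.card

end Paper

namespace Paper

/-! # Quartet relations -/

/-- The defining properties of a tree-like quartet relation, `Q a b c d` expressing that an edge of the tree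
separates `a, b` from `c, d`. -/
structure IsQuartet {α : Type*} (Q : α → α → α → α → Prop) : Prop where
  nodup : ∀ {a b c d}, Q a b c d → [a, b, c, d].Nodup
  swap : ∀ {a b c d}, Q a b c d → Q b a c d
  symm : ∀ {a b c d}, Q a b c d → Q c d a b
  thin : ∀ {a b c d}, Q a b c d → ¬ Q a c b d
  saturated : ∀ {a b c d e}, Q a b c d → e ≠ a → e ≠ b → e ≠ c → e ≠ d →
    (Q a b c e ∧ Q a b d e) ∨ (Q a e c d ∧ Q b e c d)
  trans : ∀ {a b c d e}, Q a b c d → Q b e c d → a ≠ e → Q a e c d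

namespace IsQuartet

variable {α : Type*} {Q Q' : α → α → α → α → Prop}

theorem swap_right (h : IsQuartet Q) {a b c d : α} (q : Q a b c d) : Q a b d c :=
  h.symm (h.swap (h.symm q))

theorem comap {β : Type*} (h : IsQuartet Q) {g : β → α} (hg : Function.Injective g) :
    IsQuartet fun a b c d => Q (g a) (g b) (g c) (g d) where
  nodup {a b c d} q := by
    have := h.nodup q
    exact List.Nodup.of_map g (l := [a, b, c, d]) this
  swap q := h.swap q
  symm q := h.symm q
  thin q := h.thin q
  saturated q h₁ h₂ h₃ h₄ := h.saturated q (hg.ne h₁) (hg.ne h₂) (hg.ne h₃) (hg.ne h₄)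
  trans q₁ q₂ hne := h.trans q₁ q₂ (hg.ne hne)

/-- Two quartet relations agree on the quadruples not containing both `a` and `b`. -/
def AgreeOff (Q Q' : α → α → α → α → Prop) (a b : α) : Prop :=
  ∀ x y z w, a ∉ [x, y, z, w] ∨ b ∉ [x, y, z, w] → (Q x y z w ↔ Q' x y z w)

theorem AgreeOff.swap {a b : α} (hO : AgreeOff Q Q' a b) : AgreeOff Q Q' b a :=
  fun x y z w h => hO x y z w h.symm

/-- If `Q a p b q` holds in both relations, then the quartets on `a, b, p, d` agree. -/
theorem quartet_of_agreeOff (h : IsQuartet Q) (h' : IsQuartet Q') {a b p q d : α}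
    (hO : AgreeOff Q Q' a b) (hq : Q a p b q) (hq' : Q' a p b q) :
    (Q a p b d → Q' a p b d) ∧ (Q a d b p → Q' a d b p) ∧ (Q a b p d → Q' a b p d) := by
  have hn := h.nodup hq
  simp only [List.nodup_cons, List.mem_cons, List.not_mem_nil, or_false, not_or,
    List.nodup_nil, not_false_eq_true, and_true] at hn
  obtain ⟨⟨hap, hab, haq⟩, ⟨hpb, hpq⟩, hbq⟩ := hn
  by_cases hdq : d = q
  · subst hdq
    refine ⟨fun _ => hq', fun t => ?_, fun t => ?_⟩
    · exact absurd (h.swap_right t) (fun t => h.thin (h.swap_right hq) t)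
    · exact absurd t (h.thin hq)
  have O : ∀ x y z w, a ≠ x ∧ a ≠ y ∧ a ≠ z ∧ a ≠ w ∨ b ≠ x ∧ b ≠ y ∧ b ≠ z ∧ b ≠ w →
      (Q x y z w ↔ Q' x y z w) := by
    intro x y z w hx
    exact hO x y z w (by simpa using hx)
  refine ⟨fun t => ?_, fun t => ?_, fun t => ?_⟩
  · have hn := h.nodup t
    simp only [List.nodup_cons, List.mem_cons, List.not_mem_nil, or_false, not_or,
      List.nodup_nil, not_false_eq_true, and_true] at hn
    obtain ⟨⟨-, -, had⟩, ⟨-, hpd⟩, hbd⟩ := hn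
    rcases h'.saturated hq' (Ne.symm had) (Ne.symm hpd) (Ne.symm hbd) hdq with u | u
    · exact u.1
    · have u2 := (O p d b q (by tauto)).2 u.2
      have u1 : Q a p d q := h.symm (h.trans (h.swap (h.symm t)) (h.symm hq) hdq)
      have u1' := (O a p d q (by tauto)).1 u1
      rcases h'.saturated u1' (Ne.symm hab) (Ne.symm hpb) hbd hbq with v | v
      · exact h'.swap_right v.1
      · exact absurd v.2 (h'.thin u.2)
  · have hn := h.nodup t
    simp only [List.nodup_cons, List.mem_cons, List.not_mem_nil, or_false, not_or,
      List.nodup_nil, not_false_eq_true, and_true] at hn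
    obtain ⟨⟨had, -, -⟩, ⟨hdb, hdp⟩, -⟩ := hn
    rcases h.saturated t (Ne.symm haq) (Ne.symm hdq) (Ne.symm hbq) (Ne.symm hpq) with u | u
    · have u2 := (O a d p q (by tauto)).1 u.2
      rcases h'.saturated hq' (Ne.symm had) hdp hdb hdq with v | v
      · exact absurd u2 (h'.thin (h'.swap_right v.2))
      · exact h'.symm (h'.trans (h'.symm v.1) (h'.swap (h'.symm u2)) (Ne.symm hpb))
    · exact absurd (h.swap_right u.1) (h.thin (h.swap_right hq))
  · have hn := h.nodup t
    simp only [List.nodup_cons, List.mem_cons, List.not_mem_nil, or_false, not_or,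
      List.nodup_nil, not_false_eq_true, and_true] at hn
    obtain ⟨⟨-, -, had⟩, ⟨-, hbd⟩, hpd⟩ := hn
    rcases h.saturated t (Ne.symm haq) (Ne.symm hbq) (Ne.symm hpq) (Ne.symm hdq) with u | u
    · exact absurd u.1 (h.thin hq)
    · have u1 := (O a q p d (by tauto)).1 u.1
      have u2 := (O b q p d (by tauto)).1 u.2
      exact h'.trans u1 (h'.swap u2) hab

/-- A single common quartet separating `a` from `b` determines all quartets containing both. -/
theorem imp_of_agreeOff (h : IsQuartet Q) (h' : IsQuartet Q') {a b p q : α}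
    (hO : AgreeOff Q Q' a b) (hq : Q a p b q) (hq' : Q' a p b q) (c d : α) :
    (Q a b c d → Q' a b c d) ∧ (Q a c b d → Q' a c b d) := by
  have left : ∀ {p q : α}, Q a p b q → Q' a p b q →
      (Q a b p d → Q' a b p d) ∧ (Q a p b d → Q' a p b d) := fun u u' =>
    have t := quartet_of_agreeOff h h' (d := d) hO u u'
    ⟨t.2.2, t.1⟩
  have right : ∀ {p q : α}, Q a p b q → Q' a p b q →
      (Q a b q d → Q' a b q d) ∧ (Q a q b d → Q' a q b d) := fun u u' =>
    have t := quartet_of_agreeOff h h' (d := d) hO.swap (h.symm u) (h'.symm u')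
    ⟨fun v => h'.swap (t.2.2 (h.swap v)), fun v => h'.symm (t.2.1 (h.symm v))⟩
  by_cases hca : c = a
  · subst hca
    exact ⟨fun v => by simpa using h.nodup v, fun v => by simpa using h.nodup v⟩
  by_cases hcb : c = b
  · subst hcb
    exact ⟨fun v => by simpa using h.nodup v, fun v => by simpa using h.nodup v⟩
  by_cases hcp : c = p
  · subst hcp
    exact left hq hq'
  by_cases hcq : c = q
  · subst hcq
    exact right hq hq'
  have t := quartet_of_agreeOff h h' (d := c) hO hq hq'
  have t' := quartet_of_agreeOff h h' (d := c) hO.swap (h.symm hq) (h'.symm hq')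
  rcases h.saturated hq hca hcp hcb hcq with u | u
  · exact right u.1 (t.1 u.1)
  · exact left u.1 (h'.symm (t'.1 (h.symm u.1)))

/-- No quartet with three further elements distinguishes `a` from `b`. -/
def Twin (Q : α → α → α → α → Prop) (a b : α) : Prop :=
  ∀ p q r, a ∉ [p, q, r] → b ∉ [p, q, r] → (Q a p q r ↔ Q b p q r)

theorem exists_of_not_twin (h : IsQuartet Q) {a b : α} (hT : ¬ Twin Q a b) :
    ∃ p q r, a ∉ [p, q, r] ∧ b ∉ [p, q, r] ∧
      (Q a p q r ∧ ¬ Q b p q r ∧ Q a p b q ∨ Q b p q r ∧ ¬ Q a p q r ∧ Q b p a q) := by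
  simp only [Twin, not_forall] at hT
  obtain ⟨p, q, r, ha, hb, hne⟩ := hT
  refine ⟨p, q, r, ha, hb, ?_⟩
  have key : ∀ {a b : α}, a ≠ b → b ∉ [p, q, r] → Q a p q r → ¬ Q b p q r → Q a p b q := by
    intro a b hab hb u v
    simp only [List.mem_cons, List.not_mem_nil, or_false, not_or] at hb
    rcases h.saturated u (Ne.symm hab) hb.1 hb.2.1 hb.2.2 with w | w
    · exact h.swap_right w.1
    · exact absurd (h.swap w.2) v
  have hab : a ≠ b := by rintro rfl; exact hne Iff.rfl
  by_cases u : Q a p q r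
  · have v : ¬ Q b p q r := fun v => hne ⟨fun _ => v, fun _ => u⟩
    exact Or.inl ⟨u, v, key hab hb u v⟩
  · have v : Q b p q r := by tauto
    exact Or.inr ⟨v, u, key hab.symm ha v u⟩

theorem eq_of_agreeOff_of_not_twin (h : IsQuartet Q) (h' : IsQuartet Q') {a b : α}
    (hab : a ≠ b) (hO : AgreeOff Q Q' a b) (hT : ¬ Twin Q a b) (x y z w : α) :
    Q x y z w ↔ Q' x y z w := by
  have key : ∃ p q, Q a p b q ∧ Q' a p b q := by
    obtain ⟨p, q, r, ha, hb, hc⟩ := h.exists_of_not_twin hT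
    have ha' : Q a p q r ↔ Q' a p q r := hO _ _ _ _ (by simp_all [Ne.symm hab])
    have hb' : Q b p q r ↔ Q' b p q r := hO _ _ _ _ (by simp_all)
    simp only [List.mem_cons, List.not_mem_nil, or_false, not_or] at ha hb
    rcases hc with ⟨u, v, t⟩ | ⟨u, v, t⟩
    · refine ⟨p, q, t, ?_⟩
      rcases h'.saturated (ha'.1 u) (Ne.symm hab) hb.1 hb.2.1 hb.2.2 with w | w
      · exact h'.swap_right w.1
      · exact absurd (hb'.2 (h'.swap w.2)) v
    · refine ⟨q, p, h.symm t, ?_⟩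
      rcases h'.saturated (hb'.1 u) hab ha.1 ha.2.1 ha.2.2 with w | w
      · exact h'.symm (h'.swap_right w.1)
      · exact absurd (ha'.2 (h'.swap w.2)) v
  obtain ⟨p, q, u, u'⟩ := key
  have hO' : AgreeOff Q' Q a b := fun x y z w hx => (hO x y z w hx).symm
  have both : ∀ c d, (Q a b c d ↔ Q' a b c d) ∧ (Q a c b d ↔ Q' a c b d) := fun c d =>
    have s := h.imp_of_agreeOff h' hO u u' c d
    have s' := h'.imp_of_agreeOff h hO' u' u c d
    ⟨⟨s.1, s'.1⟩, ⟨s.2, s'.2⟩⟩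
  by_cases hx : a ∉ [x, y, z, w] ∨ b ∉ [x, y, z, w]
  · exact hO x y z w hx
  have sw : ∀ x y z w, Q x y z w ↔ Q y x z w := fun _ _ _ _ => ⟨h.swap, h.swap⟩
  have sm : ∀ x y z w, Q x y z w ↔ Q z w x y := fun _ _ _ _ => ⟨h.symm, h.symm⟩
  have sw' : ∀ x y z w, Q' x y z w ↔ Q' y x z w := fun _ _ _ _ => ⟨h'.swap, h'.swap⟩
  have sm' : ∀ x y z w, Q' x y z w ↔ Q' z w x y := fun _ _ _ _ => ⟨h'.symm, h'.symm⟩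
  simp only [List.mem_cons, List.not_mem_nil, or_false, not_or, not_and_or, not_not] at hx
  have first : ∀ y z w, b = y ∨ b = z ∨ b = w → (Q a y z w ↔ Q' a y z w) := by
    rintro y z w (rfl | rfl | rfl)
    · exact (both _ _).1
    · exact (both _ _).2
    · rw [sm, sw, sm, sm', sw', sm']
      exact (both _ _).2
  rcases hx with ⟨rfl | rfl | rfl | rfl, hb⟩
  · exact first _ _ _ (by tauto)
  · rw [sw, sw']
    exact first _ _ _ (by tauto)
  · rw [sm, sm']
    exact first _ _ _ (by tauto)
  · rw [sm, sw, sm', sw']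
    exact first _ _ _ (by tauto)

end IsQuartet

/-! # Relations defined by split systems -/

/-- Two bipartitions, each represented by one of its sides, are compatible. -/
def SplitCompatible {α : Type*} (s t : Set α) : Prop :=
  (∀ x, x ∈ s → x ∈ t) ∨ (∀ x, x ∈ s → x ∉ t) ∨ (∀ x, x ∉ s → x ∈ t) ∨ (∀ x, x ∉ s → x ∉ t)

/-- `R x y z w` holds iff `x, y, z, w` are distinct and some member of a fixed compatible split
system separates both `x` from `y` and `z` from `w`. -/
def IsSplitRel {α : Type*} (R : α → α → α → α → Prop) : Prop :=
  ∃ S : Set (Set α), (∀ s ∈ S, ∀ t ∈ S, SplitCompatible s t) ∧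
    ∀ x y z w, R x y z w ↔
      [x, y, z, w].Nodup ∧ ∃ s ∈ S, (x ∈ s ↔ y ∉ s) ∧ (z ∈ s ↔ w ∉ s)

/-- The quartet relation of `R`. -/
def quartetOf {α : Type*} (R : α → α → α → α → Prop) (a b c d : α) : Prop :=
  R a c b d ∧ R a d b c

namespace IsSplitRel

variable {α : Type*} {R : α → α → α → α → Prop}

theorem comap {β : Type*} (h : IsSplitRel R) {g : β → α} (hg : Function.Injective g) :
    IsSplitRel fun x y z w => R (g x) (g y) (g z) (g w) := by
  obtain ⟨S, hS, hR⟩ := h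
  refine ⟨(fun s => g ⁻¹' s) '' S, ?_, fun x y z w => ?_⟩
  · rintro _ ⟨s, hs, rfl⟩ _ ⟨t, ht, rfl⟩
    rcases hS s hs t ht with k | k | k | k
    · exact Or.inl fun x => k (g x)
    · exact Or.inr (Or.inl fun x => k (g x))
    · exact Or.inr (Or.inr (Or.inl fun x => k (g x)))
    · exact Or.inr (Or.inr (Or.inr fun x => k (g x)))
  · beta_reduce
    rw [hR, Set.exists_mem_image]
    exact and_congr (List.nodup_map_iff hg (l := [x, y, z, w])) Iff.rfl

theorem exists_splits (h : IsSplitRel R) :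
    ∃ S : Set (Set α), (∀ s ∈ S, ∀ t ∈ S, SplitCompatible s t) ∧
      ∀ a b c d, quartetOf R a b c d ↔ [a, b, c, d].Nodup ∧
        ∃ s ∈ S, (a ∈ s ↔ b ∈ s) ∧ (c ∈ s ↔ d ∈ s) ∧ (a ∈ s ↔ c ∉ s) := by
  obtain ⟨S, hS, hR⟩ := h
  refine ⟨S, hS, fun a b c d => ?_⟩
  simp only [quartetOf, hR]
  constructor
  · rintro ⟨⟨hn, s, hs, h₁, h₂⟩, -, t, ht, h₃, h₄⟩
    refine ⟨by grind, ?_⟩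
    by_cases h₅ : a ∈ s ↔ b ∈ s
    · exact ⟨s, hs, by grind⟩
    by_cases h₆ : a ∈ t ↔ b ∈ t
    · exact ⟨t, ht, by grind⟩
    exfalso
    rcases hS s hs t ht with k | k | k | k <;> grind
  · rintro ⟨hn, s, hs, h₁, h₂, h₃⟩
    exact ⟨⟨by grind, s, hs, by grind⟩, by grind, s, hs, by grind⟩

theorem isQuartet (h : IsSplitRel R) : IsQuartet (quartetOf R) := by
  obtain ⟨S, hS, hQ⟩ := h.exists_splits
  refine ⟨?_, ?_, ?_, ?_, ?_, ?_⟩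
  · intro a b c d q
    exact ((hQ _ _ _ _).1 q).1
  · intro a b c d q
    obtain ⟨hn, s, hs, k⟩ := (hQ _ _ _ _).1 q
    exact (hQ _ _ _ _).2 ⟨by grind, s, hs, by grind⟩
  · intro a b c d q
    obtain ⟨hn, s, hs, k⟩ := (hQ _ _ _ _).1 q
    exact (hQ _ _ _ _).2 ⟨by grind, s, hs, by grind⟩
  · intro a b c d q q'
    obtain ⟨-, s, hs, h₁⟩ := (hQ _ _ _ _).1 q
    obtain ⟨-, t, ht, h₂⟩ := (hQ _ _ _ _).1 q'
    rcases hS s hs t ht with k | k | k | k <;> grind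
  · intro a b c d e q h₁ h₂ h₃ h₄
    obtain ⟨hn, s, hs, k⟩ := (hQ _ _ _ _).1 q
    simp only [hQ]
    by_cases he : e ∈ s ↔ c ∈ s
    · exact Or.inl ⟨⟨by grind, s, hs, by grind⟩, ⟨by grind, s, hs, by grind⟩⟩
    · exact Or.inr ⟨⟨by grind, s, hs, by grind⟩, ⟨by grind, s, hs, by grind⟩⟩
  · intro a b c d e q q' hne
    obtain ⟨hn, s, hs, h₁⟩ := (hQ _ _ _ _).1 q
    obtain ⟨hn', t, ht, h₂⟩ := (hQ _ _ _ _).1 q'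
    refine (hQ _ _ _ _).2 ⟨by grind, ?_⟩
    by_cases h₅ : a ∈ s ↔ e ∈ s
    · exact ⟨s, hs, by grind⟩
    by_cases h₆ : a ∈ t ↔ e ∈ t
    · exact ⟨t, ht, by grind⟩
    exfalso
    rcases hS s hs t ht with k | k | k | k <;> grind

theorem iff_quartetOf (h : IsSplitRel R) (x y z w : α) :
    R x y z w ↔ quartetOf R x z y w ∨ quartetOf R x w y z := by
  obtain ⟨S, -, hR⟩ := h
  simp only [quartetOf, hR]
  constructor
  · rintro ⟨hn, s, hs, k⟩
    by_cases he : x ∈ s ↔ z ∈ s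
    · exact Or.inl ⟨⟨hn, s, hs, k⟩, by grind, s, hs, by grind⟩
    · exact Or.inr ⟨⟨by grind, s, hs, by grind⟩, by grind, s, hs, by grind⟩
  · rintro (⟨k, -⟩ | ⟨⟨hn, s, hs, k⟩, -⟩)
    · exact k
    · exact ⟨by grind, s, hs, by grind⟩

end IsSplitRel

/-! # The splits of a tree -/

namespace FinTree

variable (T : FinTree)

theorem mem_edges_iff_not_reachable {x y : T.V} {p : T.G.Walk x y} (hp : p.IsPath) (e : Sym2 T.V) :
    e ∈ p.edges ↔ ¬ (T.G.deleteEdges {e}).Reachable x y := by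
  induction e with | h u v =>
  rw [SimpleGraph.reachable_deleteEdges_iff_exists_walk]
  constructor
  · rintro h ⟨q, hq⟩
    have heq : p = (q.toPath : T.G.Walk x y) :=
      (T.isTree.existsUnique_path x y).unique hp q.toPath.2
    rw [heq] at h
    exact hq (q.edges_toPath_subset_edges h)
  · intro h
    by_contra hn
    exact h ⟨p, hn⟩

theorem pathRel_iff (x y z w : T.V) : T.pathRel x y z w ↔ [x, y, z, w].Nodup ∧
    ∃ e ∈ T.G.edgeSet, ¬ (T.G.deleteEdges {e}).Reachable x y ∧
      ¬ (T.G.deleteEdges {e}).Reachable z w := by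
  refine and_congr Iff.rfl ⟨?_, ?_⟩
  · rintro ⟨p, q, hp, hq, e, he, he'⟩
    exact ⟨e, p.edges_subset_edgeSet he, (T.mem_edges_iff_not_reachable hp e).1 he,
      (T.mem_edges_iff_not_reachable hq e).1 he'⟩
  · rintro ⟨e, -, he, he'⟩
    obtain ⟨p, hp⟩ := T.isTree.connected.exists_isPath x y
    obtain ⟨q, hq⟩ := T.isTree.connected.exists_isPath z w
    exact ⟨p, q, hp, hq, e, (T.mem_edges_iff_not_reachable hp e).2 he,
      (T.mem_edges_iff_not_reachable hq e).2 he'⟩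

/-- The side of `u` in the split of the tree induced by the edge `u v`. -/
def side (u v : T.V) : Set T.V := {w | (T.G.deleteEdges {s(u, v)}).Reachable w u}

theorem reachable_right_of_notMem_side {u v w : T.V} (hw : w ∉ T.side u v) :
    (T.G.deleteEdges {s(u, v)}).Reachable w v := by
  have key : ∀ (w x : T.V) (_ : T.G.Walk w x), x = u →
      (T.G.deleteEdges {s(u, v)}).Reachable w u ∨ (T.G.deleteEdges {s(u, v)}).Reachable w v := by
    intro w x p
    induction p with
    | nil => rintro rfl; exact Or.inl (SimpleGraph.Reachable.refl _)
    | @cons w z x h p ih =>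
      intro hx
      by_cases he : s(w, z) = s(u, v)
      · rcases Sym2.eq_iff.1 he with ⟨rfl, rfl⟩ | ⟨rfl, rfl⟩
        · exact Or.inl (SimpleGraph.Reachable.refl _)
        · exact Or.inr (SimpleGraph.Reachable.refl _)
      · have hr : (T.G.deleteEdges {s(u, v)}).Reachable w z :=
          SimpleGraph.Adj.reachable (SimpleGraph.deleteEdges_adj.2 ⟨h, he⟩)
        exact (ih hx).imp hr.trans hr.trans
  obtain ⟨p⟩ := T.isTree.connected.preconnected w u
  exact (key w u p rfl).resolve_left hw

theorem reachable_iff_side (u v x y : T.V) : (T.G.deleteEdges {s(u, v)}).Reachable x y ↔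
    (x ∈ T.side u v ↔ y ∈ T.side u v) := by
  constructor
  · intro h
    exact ⟨fun hx => h.symm.trans hx, fun hy => h.trans hy⟩
  · intro h
    by_cases hx : x ∈ T.side u v
    · exact hx.trans (h.1 hx).symm
    · exact (T.reachable_right_of_notMem_side hx).trans
        (T.reachable_right_of_notMem_side fun hy => hx (h.2 hy)).symm

theorem reachable_deleteEdges_of_not_reachable {e : Sym2 T.V} {x y : T.V}
    (hxy : (T.G.deleteEdges {e}).Reachable x y) {w w' : T.V}
    (h : (T.G.deleteEdges {e}).Reachable w w') (hw : ¬ (T.G.deleteEdges {e}).Reachable w x) :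
    (T.G.deleteEdges {s(x, y)}).Reachable w w' := by
  obtain ⟨p⟩ := h
  induction p with
  | nil => exact SimpleGraph.Reachable.refl _
  | @cons w z w' h p ih =>
    refine SimpleGraph.Reachable.trans (SimpleGraph.Adj.reachable
      (SimpleGraph.deleteEdges_adj.2 ⟨(SimpleGraph.deleteEdges_adj.1 h).1, ?_⟩))
      (ih fun hz => hw (h.reachable.trans hz))
    intro he
    rcases Sym2.eq_iff.1 he with ⟨rfl, rfl⟩ | ⟨rfl, rfl⟩
    · exact hw (SimpleGraph.Reachable.refl _)
    · exact hw hxy.symm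

theorem splitCompatible_side {u v x y : T.V} (huv : T.G.Adj u v) (hxy : T.G.Adj x y) :
    SplitCompatible (T.side u v) (T.side x y) := by
  by_cases he : s(x, y) = s(u, v)
  · rcases Sym2.eq_iff.1 he with ⟨rfl, rfl⟩ | ⟨rfl, rfl⟩
    · exact Or.inl fun _ h => h
    · refine Or.inr (Or.inl fun w hw hw' => ?_)
      have hb := SimpleGraph.isAcyclic_iff_forall_adj_isBridge.1 T.isTree.isAcyclic huv
      rw [SimpleGraph.isBridge_iff] at hb
      unfold side at hw hw'
      rw [Sym2.eq_swap] at hw'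
      exact hb (hw.symm.trans hw')
  have hr : (T.G.deleteEdges {s(u, v)}).Reachable x y :=
    SimpleGraph.Adj.reachable (SimpleGraph.deleteEdges_adj.2 ⟨hxy, he⟩)
  by_cases hx : x ∈ T.side u v
  · have hc : ∀ w, w ∉ T.side u v → ∀ w', w' ∉ T.side u v → w ∈ T.side x y → w' ∈ T.side x y := by
      intro w hw w' hw'
      refine ((T.reachable_iff_side x y w w').1
        (T.reachable_deleteEdges_of_not_reachable hr ?_ ?_)).1
      · exact (T.reachable_iff_side u v w w').2 (by tauto)
      · rw [T.reachable_iff_side]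
        tauto
    by_cases h : ∃ w, w ∉ T.side u v ∧ w ∈ T.side x y
    · obtain ⟨w, hw, hw'⟩ := h
      exact Or.inr (Or.inr (Or.inl fun z hz => hc w hw z hz hw'))
    · exact Or.inr (Or.inr (Or.inr fun z hz hz' => h ⟨z, hz, hz'⟩))
  · have hc : ∀ w, w ∈ T.side u v → ∀ w', w' ∈ T.side u v → w ∈ T.side x y → w' ∈ T.side x y := by
      intro w hw w' hw'
      refine ((T.reachable_iff_side x y w w').1
        (T.reachable_deleteEdges_of_not_reachable hr ?_ ?_)).1
      · exact (T.reachable_iff_side u v w w').2 (by tauto)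
      · rw [T.reachable_iff_side]
        tauto
    by_cases h : ∃ w, w ∈ T.side u v ∧ w ∈ T.side x y
    · obtain ⟨w, hw, hw'⟩ := h
      exact Or.inl fun z hz => hc w hw z hz hw'
    · exact Or.inr (Or.inl fun z hz hz' => h ⟨z, hz, hz'⟩)

theorem isSplitRel_pathRel : IsSplitRel T.pathRel := by
  refine ⟨{s | ∃ u v, T.G.Adj u v ∧ s = T.side u v}, ?_, fun x y z w => ?_⟩
  · rintro _ ⟨u, v, huv, rfl⟩ _ ⟨x, y, hxy, rfl⟩
    exact T.splitCompatible_side huv hxy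
  · rw [pathRel_iff]
    refine and_congr Iff.rfl ⟨?_, ?_⟩
    · rintro ⟨e, he, h₁, h₂⟩
      induction e with | h u v =>
      rw [T.reachable_iff_side] at h₁ h₂
      exact ⟨_, ⟨u, v, he, rfl⟩, by tauto, by tauto⟩
    · rintro ⟨_, ⟨u, v, huv, rfl⟩, h₁, h₂⟩
      refine ⟨s(u, v), huv, ?_, ?_⟩ <;> rw [T.reachable_iff_side] <;> tauto

/-! # Removing a leaf -/

/-- The tree obtained by removing a leaf. -/
def removeLeaf (v : T.V) (hv : T.G.degree v = 1) : FinTree where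
  V := ({v}ᶜ : Set T.V)
  G := T.G.induce {v}ᶜ
  isTree := ⟨T.isTree.connected.induce_compl_singleton_of_degree_eq_one hv,
    T.isTree.isAcyclic.induce _⟩

theorem isLeaf_removeLeaf {v : T.V} (hv : T.G.degree v = 1) {w : T.V} (hw : T.IsLeaf w)
    (hwv : w ∈ ({v}ᶜ : Set T.V)) : (T.removeLeaf v hv).IsLeaf ⟨w, hwv⟩ := by
  refine le_trans ?_ hw
  unfold removeLeaf
  refine Finset.card_le_card_of_injOn Subtype.val ?_ Subtype.val_injective.injOn
  intro x hx
  simpa using hx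

theorem pathRel_map {T T' : FinTree} (f : T'.G →g T.G) (hf : Function.Injective f)
    (x y z w : T'.V) : T.pathRel (f x) (f y) (f z) (f w) ↔ T'.pathRel x y z w := by
  refine and_congr (List.nodup_map_iff hf (l := [x, y, z, w])) ⟨?_, ?_⟩
  · rintro ⟨p, q, hp, hq, e, he, he'⟩
    obtain ⟨p', hp'⟩ := T'.isTree.connected.exists_isPath x y
    obtain ⟨q', hq'⟩ := T'.isTree.connected.exists_isPath z w
    have e₁ : p = p'.map f := (T.isTree.existsUnique_path _ _).unique hp (hp'.map hf)
    have e₂ : q = q'.map f := (T.isTree.existsUnique_path _ _).unique hq (hq'.map hf)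
    rw [e₁, SimpleGraph.Walk.edges_map, List.mem_map] at he
    rw [e₂, SimpleGraph.Walk.edges_map, List.mem_map] at he'
    obtain ⟨a, ha, rfl⟩ := he
    obtain ⟨b, hb, hab⟩ := he'
    rw [Sym2.map.injective hf hab] at hb
    exact ⟨p', q', hp', hq', a, ha, hb⟩
  · rintro ⟨p, q, hp, hq, e, he, he'⟩
    refine ⟨p.map f, q.map f, hp.map hf, hq.map hf, Sym2.map f e, ?_, ?_⟩ <;>
    · rw [SimpleGraph.Walk.edges_map]
      exact List.mem_map_of_mem ‹_›

theorem pathRel_removeLeaf {v : T.V} (hv : T.G.degree v = 1)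
    (x y z w : ({v}ᶜ : Set T.V)) :
    T.pathRel x y z w ↔ (T.removeLeaf v hv).pathRel x y z w :=
  pathRel_map (T' := T.removeLeaf v hv) (SimpleGraph.Embedding.induce {v}ᶜ).toHom
    Subtype.val_injective x y z w

end FinTree

/-! # Tree structures -/

/-- The relation of a structure for the tree signature, as a function of four variables. -/
def Struc.quat (X : Struc treeSig) (x y z w : X.carrier) : Prop := X.rel () ![x, y, z, w]

theorem Struc.rel_iff_quat (X : Struc treeSig) (i : Unit) (v : Fin 4 → X.carrier) :
    X.rel i v ↔ X.quat (v 0) (v 1) (v 2) (v 3) := by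
  have : v = ![v 0, v 1, v 2, v 3] := by
    funext j
    fin_cases j <;> rfl
  unfold quat
  rw [← this]

theorem Emb.quat_iff {X Y : Struc treeSig} (f : Emb X Y) (x y z w : X.carrier) :
    Y.quat (f.toFun x) (f.toFun y) (f.toFun z) (f.toFun w) ↔ X.quat x y z w :=
  (Y.rel_iff_quat () fun j => f.toFun (![x, y, z, w] j)).symm.trans (f.rel_iff () ![x, y, z, w])

theorem Struc.quat_restrict (X : Struc treeSig) (S : Set X.carrier) (x y z w : S) :
    (X.restrict S).quat x y z w ↔ X.quat x y z w :=
  ((X.subEmb S).quat_iff x y z w).symm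

/-- An embedding of structures for the tree signature from an injection compatible with `quat`. -/
def Emb.ofQuat {X Y : Struc treeSig} (f : X.carrier → Y.carrier) (hf : Function.Injective f)
    (h : ∀ x y z w, Y.quat (f x) (f y) (f z) (f w) ↔ X.quat x y z w) : Emb X Y where
  toFun := f
  inj := hf
  rel_iff i v := (Y.rel_iff_quat i fun j => f (v j)).trans
    ((h _ _ _ _).trans (X.rel_iff_quat i v).symm)

theorem mem_treeClass_of_emb_leafStruc (n : ℕ) : ∀ (T : FinTree), Fintype.card T.V = n →
    ∀ (Y : Struc treeSig), Emb Y T.leafStruc → Y ∈ TreeClass := by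
  induction n with
  | zero =>
    intro T hT Y f
    have := Fintype.card_eq_zero_iff.1 hT
    exact Or.inl ⟨fun y => this.false (f.toFun y).1⟩
  | succ n ih =>
    intro T hT Y f
    by_cases hf : f.IsIso
    · exact Or.inr ⟨T, f, hf⟩
    simp only [Emb.IsIso, Function.Surjective, not_forall, not_exists] at hf
    obtain ⟨⟨v, hv⟩, hvf⟩ := hf
    have hne : ∀ y, (f.toFun y).1 ≠ v := fun y h => hvf y (Subtype.ext h)
    by_cases hd : T.G.degree v = 1
    · refine ih (T.removeLeaf v hd) ?_ Y (Emb.ofQuat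
        (fun y => ⟨⟨(f.toFun y).1, hne y⟩, T.isLeaf_removeLeaf hd (f.toFun y).2 (hne y)⟩) ?_ ?_)
      · change Fintype.card ({v}ᶜ : Set T.V) = n
        rw [Fintype.card_compl_set]
        simp [hT]
      · intro y y' h
        exact f.inj (Subtype.ext (congrArg (fun t => t.1.1) h))
      · intro x y z w
        rw [← f.quat_iff]
        exact (T.pathRel_removeLeaf hd ⟨_, hne x⟩ ⟨_, hne y⟩ ⟨_, hne z⟩ ⟨_, hne w⟩).symm
    · refine Or.inl ⟨fun y => ?_⟩
      have hle : T.G.degree v ≤ 1 := hv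
      have : Nontrivial T.V := ⟨_, _, hne y⟩
      have := T.isTree.connected.preconnected.degree_pos_of_nontrivial v
      omega

theorem exists_emb_leafStruc {X : Struc treeSig} (hX : MemUpIso TreeClass X) (x : X.carrier) :
    ∃ T : FinTree, Nonempty (Emb X T.leafStruc) := by
  obtain ⟨W, hW | ⟨T, g, -⟩, f, -⟩ := hX
  · exact (hW.false (f.toFun x)).elim
  · exact ⟨T, ⟨g.comp f⟩⟩

theorem mem_treeClass_of_emb {X Y : Struc treeSig} (hX : MemUpIso TreeClass X) (f : Emb Y X) :
    Y ∈ TreeClass := by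
  by_cases hY : IsEmpty Y.carrier
  · exact Or.inl hY
  obtain ⟨y⟩ := not_isEmpty_iff.1 hY
  obtain ⟨T, ⟨g⟩⟩ := exists_emb_leafStruc hX (f.toFun y)
  exact mem_treeClass_of_emb_leafStruc _ T rfl Y (g.comp f)

theorem isSplitRel_quat {X : Struc treeSig} (hX : MemUpIso TreeClass X) (x : X.carrier) :
    IsSplitRel X.quat := by
  obtain ⟨T, ⟨f⟩⟩ := exists_emb_leafStruc hX x
  have h := T.isSplitRel_pathRel.comap (g := fun x => (f.toFun x).1)
    (Subtype.val_injective.comp f.inj)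
  convert h using 5
  exact (f.quat_iff _ _ _ _).symm

theorem Emb.not_twin {X Y : Struc treeSig} (f : Emb X Y) {a b : X.carrier}
    (h : ¬ IsQuartet.Twin (quartetOf X.quat) a b) :
    ¬ IsQuartet.Twin (quartetOf Y.quat) (f.toFun a) (f.toFun b) := by
  contrapose! h
  intro p q r ha hb
  have := h (f.toFun p) (f.toFun q) (f.toFun r) (by simpa [f.inj.eq_iff] using ha)
    (by simpa [f.inj.eq_iff] using hb)
  simpa only [quartetOf, f.quat_iff] using this

/-- The map identifying `b` with `a`. -/
noncomputable def identify {α : Type*} (a b x : α) : α :=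
  open Classical in if x = b then a else x

theorem quat_identify {X : Struc treeSig} (hX : MemUpIso TreeClass X) {a b : X.carrier}
    (hT : IsQuartet.Twin (quartetOf X.quat) a b) {x y z w : X.carrier}
    (hx : x ≠ a) (hy : y ≠ a) (hz : z ≠ a) (hw : w ≠ a) :
    X.quat (identify a b x) (identify a b y) (identify a b z) (identify a b w) ↔
      X.quat x y z w := by
  have hS := isSplitRel_quat hX a
  have hQ := hS.isQuartet
  rw [hS.iff_quartetOf, hS.iff_quartetOf x]
  have hinj : ∀ s t, s ≠ a → t ≠ a → identify a b s = identify a b t → s = t := by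
    intro s t hs ht h
    unfold identify at h
    grind
  have key : ∀ x y z w, x ≠ a → y ≠ a → z ≠ a → w ≠ a →
      (quartetOf X.quat (identify a b x) (identify a b y) (identify a b z) (identify a b w) ↔
        quartetOf X.quat x y z w) := by
    intro x y z w hx hy hz hw
    by_cases hn : [x, y, z, w].Nodup
    swap
    · refine iff_of_false (fun h => hn ?_) (fun h => hn (hQ.nodup h))
      exact List.Nodup.of_map (identify a b) (l := [x, y, z, w]) (hQ.nodup h)
    have ne : ∀ t, t ≠ b → identify a b t = t := fun t ht => if_neg ht
    have eq : identify a b b = a := if_pos rfl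
    have sw : ∀ x y z w, quartetOf X.quat x y z w ↔ quartetOf X.quat y x z w :=
      fun _ _ _ _ => ⟨hQ.swap, hQ.swap⟩
    have sm : ∀ x y z w, quartetOf X.quat x y z w ↔ quartetOf X.quat z w x y :=
      fun _ _ _ _ => ⟨hQ.symm, hQ.symm⟩
    have T : ∀ p q r, p ≠ a → q ≠ a → r ≠ a → p ≠ b → q ≠ b → r ≠ b →
        (quartetOf X.quat a p q r ↔ quartetOf X.quat b p q r) := by
      intro p q r h₁ h₂ h₃ h₄ h₅ h₆
      exact hT p q r (by simp [h₁.symm, h₂.symm, h₃.symm]) (by simp [h₄.symm, h₅.symm, h₆.symm])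
    simp only [List.nodup_cons, List.mem_cons, List.not_mem_nil, or_false, not_or,
      List.nodup_nil, not_false_eq_true, and_true] at hn
    obtain ⟨⟨hxy, hxz, hxw⟩, ⟨hyz, hyw⟩, hzw⟩ := hn
    by_cases h₁ : x = b
    · subst h₁
      rw [eq, ne y (Ne.symm hxy), ne z (Ne.symm hxz), ne w (Ne.symm hxw)]
      exact T y z w hy hz hw (Ne.symm hxy) (Ne.symm hxz) (Ne.symm hxw)
    by_cases h₂ : y = b
    · subst h₂
      rw [eq, ne x hxy, ne z (Ne.symm hyz), ne w (Ne.symm hyw), sw, sw x]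
      exact T x z w hx hz hw hxy (Ne.symm hyz) (Ne.symm hyw)
    by_cases h₃ : z = b
    · subst h₃
      rw [eq, ne x hxz, ne y hyz, ne w (Ne.symm hzw), sm, sm x]
      exact T w x y hw hx hy (Ne.symm hzw) hxz hyz
    by_cases h₄ : w = b
    · subst h₄
      rw [eq, ne x hxw, ne y hyw, ne z hzw, sm, sw, sm x, sw z]
      exact T z x y hz hx hy hzw hxw hyw
    · rw [ne x h₁, ne y h₂, ne z h₃, ne w h₄]
  rw [key x z y w hx hz hy hw, key x w y z hx hw hy hz]

theorem not_twin_of_separated {X : Struc treeSig} (hX : MemUpIso TreeClass X) {a b : X.carrier}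
    {hab : a ≠ b} (h : Separated TreeClass X a b hab) :
    ¬ IsQuartet.Twin (quartetOf X.quat) a b := by
  intro hT
  have hne : ∀ x : X.carrier, x ≠ a → identify a b x ∈ ({b} : Set X.carrier)ᶜ := by
    intro x hx
    simp only [identify, Set.mem_compl_iff, Set.mem_singleton_iff]
    grind
  let A : Amalg (X.inclEmb (pair_compl_subset_left a b))
      (X.inclEmb (pair_compl_subset_right a b)) :=
    { Z := X.restrict {b}ᶜ
      j₁ := Emb.ofQuat (fun x => ⟨identify a b x.1, hne x.1 x.2⟩)
        (fun x y hxy => by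
          have hx : x.1 ≠ a := x.2
          have hy : y.1 ≠ a := y.2
          have := congrArg Subtype.val hxy
          simp only [identify] at this
          exact Subtype.ext (by grind))
        (fun x y z w => (X.quat_restrict _ _ _ _ _).trans
          ((quat_identify hX hT x.2 y.2 z.2 w.2).trans (X.quat_restrict _ _ _ _ _).symm))
      j₂ := Emb.id _
      comm := fun x => Subtype.ext (if_neg fun hx => x.2 (Or.inr hx))
      surj := fun z => Or.inr ⟨z, rfl⟩ }
  obtain ⟨f, -, h₁, h₂⟩ := h A (memUpIso_of_mem (mem_treeClass_of_emb hX (X.subEmb _)))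
  have e₁ := h₁ ⟨b, hab.symm⟩
  have e₂ := h₂ ⟨a, hab⟩
  have e : A.j₁.toFun ⟨b, hab.symm⟩ = A.j₂.toFun ⟨a, hab⟩ := Subtype.ext (if_pos rfl)
  rw [e, e₂] at e₁
  exact hab e₁

theorem separated_of_not_twin {X : Struc treeSig} (hX : MemUpIso TreeClass X) {a b : X.carrier}
    (hab : a ≠ b) (hT : ¬ IsQuartet.Twin (quartetOf X.quat) a b) :
    Separated TreeClass X a b hab := by
  intro A hA
  classical
  let g : X.carrier → A.Z.carrier := fun x =>
    if h : x = a then A.j₂.toFun ⟨a, hab⟩ else A.j₁.toFun ⟨x, h⟩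
  have g₁ : ∀ x : (({a} : Set X.carrier)ᶜ : Set X.carrier), g x.1 = A.j₁.toFun x :=
    fun x => dif_neg x.2
  have g₂ : ∀ x : (({b} : Set X.carrier)ᶜ : Set X.carrier), g x.1 = A.j₂.toFun x := by
    intro x
    by_cases hx : x.1 = a
    · have : x = ⟨a, hab⟩ := Subtype.ext hx
      subst this
      exact dif_pos rfl
    · rw [g₁ ⟨x.1, hx⟩]
      exact A.comm ⟨x.1, fun h => h.elim hx x.2⟩
  have hO₁ : ∀ x y z w, x ≠ a → y ≠ a → z ≠ a → w ≠ a →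
      (A.Z.quat (g x) (g y) (g z) (g w) ↔ X.quat x y z w) := by
    intro x y z w hx hy hz hw
    rw [g₁ ⟨x, hx⟩, g₁ ⟨y, hy⟩, g₁ ⟨z, hz⟩, g₁ ⟨w, hw⟩]
    exact (A.j₁.quat_iff _ _ _ _).trans (X.quat_restrict _ _ _ _ _)
  have hO₂ : ∀ x y z w, x ≠ b → y ≠ b → z ≠ b → w ≠ b →
      (A.Z.quat (g x) (g y) (g z) (g w) ↔ X.quat x y z w) := by
    intro x y z w hx hy hz hw
    rw [g₂ ⟨x, hx⟩, g₂ ⟨y, hy⟩, g₂ ⟨z, hz⟩, g₂ ⟨w, hw⟩]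
    exact (A.j₂.quat_iff _ _ _ _).trans (X.quat_restrict _ _ _ _ _)
  have hO : IsQuartet.AgreeOff (quartetOf X.quat)
      (fun x y z w => quartetOf A.Z.quat (g x) (g y) (g z) (g w)) a b := by
    intro x y z w h
    simp only [List.mem_cons, List.not_mem_nil, or_false, not_or] at h
    rcases h with ⟨h₁, h₂, h₃, h₄⟩ | ⟨h₁, h₂, h₃, h₄⟩
    · exact and_congr (hO₁ _ _ _ _ (Ne.symm h₁) (Ne.symm h₃) (Ne.symm h₂) (Ne.symm h₄)).symm
        (hO₁ _ _ _ _ (Ne.symm h₁) (Ne.symm h₄) (Ne.symm h₂) (Ne.symm h₃)).symm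
    · exact and_congr (hO₂ _ _ _ _ (Ne.symm h₁) (Ne.symm h₃) (Ne.symm h₂) (Ne.symm h₄)).symm
        (hO₂ _ _ _ _ (Ne.symm h₁) (Ne.symm h₄) (Ne.symm h₂) (Ne.symm h₃)).symm
  have hgab : g a ≠ g b := by
    intro he
    refine hT fun p q r ha hb => ?_
    have ea := hO a p q r (Or.inr (by
      simp only [List.mem_cons] at hb ⊢
      tauto))
    have eb := hO b p q r (Or.inl (by
      simp only [List.mem_cons] at ha ⊢
      tauto))
    rw [ea, eb]
    simp only [he]
  have hg : Function.Injective g := by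
    intro x y hxy
    by_cases hx : x = a
    · by_cases hy : y = b
      · exact absurd (hx ▸ hy ▸ hxy) hgab
      · have hxb : x ≠ b := hx ▸ hab
        rw [g₂ ⟨x, hxb⟩, g₂ ⟨y, hy⟩] at hxy
        exact congrArg Subtype.val (A.j₂.inj hxy)
    · by_cases hy : y = a
      · by_cases hx' : x = b
        · exact absurd (hx' ▸ hy ▸ hxy.symm) hgab
        · have hyb : y ≠ b := hy ▸ hab
          rw [g₂ ⟨x, hx'⟩, g₂ ⟨y, hyb⟩] at hxy
          exact congrArg Subtype.val (A.j₂.inj hxy)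
      · rw [g₁ ⟨x, hx⟩, g₁ ⟨y, hy⟩] at hxy
        exact congrArg Subtype.val (A.j₁.inj hxy)
  have hsurj : Function.Surjective g := by
    intro z
    rcases A.surj z with ⟨x, rfl⟩ | ⟨x, rfl⟩
    · exact ⟨x.1, g₁ x⟩
    · exact ⟨x.1, g₂ x⟩
  have hX' := isSplitRel_quat hX a
  have hZ := isSplitRel_quat hA (g a)
  have hall : ∀ x y z w, A.Z.quat (g x) (g y) (g z) (g w) ↔ X.quat x y z w := by
    intro x y z w
    have e := hX'.isQuartet.eq_of_agreeOff_of_not_twin (hZ.isQuartet.comap hg) hab hO hT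
    rw [hZ.iff_quartetOf, hX'.iff_quartetOf, e, e]
  let G := Equiv.ofBijective g ⟨hg, hsurj⟩
  refine ⟨Emb.ofQuat G.symm G.symm.injective fun x y z w => ?_, G.symm.surjective,
    fun y => ?_, fun y => ?_⟩
  · have := hall (G.symm x) (G.symm y) (G.symm z) (G.symm w)
    change A.Z.quat (G _) (G _) (G _) (G _) ↔ X.quat _ _ _ _ at this
    simp only [Equiv.apply_symm_apply] at this
    exact this.symm
  · exact G.symm_apply_eq.2 (g₁ y).symm
  · exact G.symm_apply_eq.2 (g₂ y).symm

/-- **Corollary 3.4**: for tree structures, "separated" and "stably separated" coincide. -/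
theorem separated_iff_stablySeparated_tree (X : Struc treeSig) (hX : X ∈ TreeClass)
    (a b : X.carrier) (hab : a ≠ b) :
    Separated TreeClass X a b hab ↔ StablySeparated TreeClass X a b hab := by
  have hX' := memUpIso_of_mem hX
  exact ⟨fun h Y hY f => separated_of_not_twin hY _ (f.not_twin (not_twin_of_separated hX' h)),
    fun h => h X hX' (Emb.id X)⟩

end Paper
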